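/- (Decision tree / OLS equivalence on training data.) Let S = {s_1, …, s_m} be the splits of a rooted binary tree on the training indices: each s_j splits node v_j into nonempty disjoint children v_{L,j}, v_{R,j}; the node of exactly one split (the root split) is the full index set {1,…,n}; the node of every other split is a child (v_{L,j} or v_{R,j}) of exactly one split; and distinct splits have distinct nodes. Call a child set ℓ (some v_{L,j} or v_{R,j}) a leaf if it is not the node of any split in S. Then for every leaf ℓ and every training index i ∈ ℓ, the OLS fit on the stump basis reproduces the tree's leaf-mean prediction: ȳ + Σ_{j=1}^{m} (Σ_{i′=1}^{n} y_{i′} ψ(i′; s_j) / |v_j|) · ψ(i; s_j) = ȳ_ℓ, where ȳ = n⁻¹ Σ_{i=1}^{n} y_i and ȳ_ℓ = |ℓ|⁻¹ Σ_{i∈ℓ} y_i. -/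

import Mathlib

open Finset

variable {n : ℕ}

/-- Mean response of the training samples in node `v`. -/
noncomputable def nodeMean (y : Fin n → ℝ) (v : Finset (Fin n)) : ℝ :=
  ((v.card : ℝ))⁻¹ * ∑ i ∈ v, y i

/-- Stump function of the split of a node into children `vL`, `vR`. -/
noncomputable def stump (vL vR : Finset (Fin n)) (i : Fin n) : ℝ :=
  ((vR.card : ℝ) * (if i ∈ vL then (1 : ℝ) else 0)
      - (vL.card : ℝ) * (if i ∈ vR then (1 : ℝ) else 0))
    / Real.sqrt ((vL.card : ℝ) * (vR.card : ℝ))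

/-- Impurity decrease of the split of node `vL ∪ vR` into children `vL`, `vR`. -/
noncomputable def impurityDecrease (y : Fin n → ℝ) (vL vR : Finset (Fin n)) : ℝ :=
  (((vL ∪ vR).card : ℝ))⁻¹ *
    ((∑ i ∈ vL ∪ vR, (y i - nodeMean y (vL ∪ vR)) ^ 2)
      - (∑ i ∈ vL, (y i - nodeMean y vL) ^ 2)
      - (∑ i ∈ vR, (y i - nodeMean y vR) ^ 2))

theorem sum_mul_stump (y : Fin n → ℝ) (vL vR : Finset (Fin n)) :
    ∑ i, y i * stump vL vR i =
      ((vR.card : ℝ) * ∑ i ∈ vL, y i - (vL.card : ℝ) * ∑ i ∈ vR, y i)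
        / Real.sqrt ((vL.card : ℝ) * (vR.card : ℝ)) := by
  have h : ∀ s : Finset (Fin n), ∑ i ∈ s, y i = ∑ i, y i * (if i ∈ s then (1 : ℝ) else 0) := by
    intro s
    simp
  rw [h vL, h vR, Finset.mul_sum, Finset.mul_sum, ← Finset.sum_sub_distrib, Finset.sum_div]
  refine Finset.sum_congr rfl fun i _ => ?_
  unfold stump
  ring

theorem stump_of_notMem {vL vR : Finset (Fin n)} {i : Fin n} (hi : i ∉ vL ∪ vR) :
    stump vL vR i = 0 := by
  rw [Finset.mem_union, not_or] at hi
  simp [stump, hi.1, hi.2]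

theorem stump_swap (vL vR : Finset (Fin n)) (i : Fin n) : stump vR vL i = -stump vL vR i := by
  unfold stump
  rw [mul_comm (vR.card : ℝ) (vL.card : ℝ)]
  ring

/-- On the left child, the fitted stump term moves the mean of the node to that of the child. -/
theorem stump_term_of_mem_left (y : Fin n → ℝ) {vL vR : Finset (Fin n)}
    (hR : vR.Nonempty) (hd : Disjoint vL vR) {i : Fin n} (hi : i ∈ vL) :
    (∑ i', y i' * stump vL vR i') / ((vL ∪ vR).card : ℝ) * stump vL vR i
      = nodeMean y vL - nodeMean y (vL ∪ vR) := by
  have hi' : i ∉ vR := Finset.disjoint_left.mp hd hi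
  have hLpos : (0 : ℝ) < vL.card := by exact_mod_cast Finset.card_pos.mpr ⟨i, hi⟩
  have hRpos : (0 : ℝ) < vR.card := by exact_mod_cast Finset.card_pos.mpr hR
  have hsq := Real.mul_self_sqrt (mul_pos hLpos hRpos).le
  have hs : stump vL vR i = (vR.card : ℝ) / Real.sqrt ((vL.card : ℝ) * (vR.card : ℝ)) := by
    simp [stump, hi, hi']
  rw [sum_mul_stump, hs]
  unfold nodeMean
  rw [Finset.sum_union hd, Finset.card_union_of_disjoint hd, Nat.cast_add,
    div_right_comm, div_mul_div_comm, hsq]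
  field_simp
  ring

theorem stump_term_of_mem_right (y : Fin n → ℝ) {vL vR : Finset (Fin n)}
    (hL : vL.Nonempty) (hd : Disjoint vL vR) {i : Fin n} (hi : i ∈ vR) :
    (∑ i', y i' * stump vL vR i') / ((vL ∪ vR).card : ℝ) * stump vL vR i
      = nodeMean y vR - nodeMean y (vL ∪ vR) := by
  have h := stump_term_of_mem_left y hL hd.symm hi
  simp only [stump_swap vL vR, mul_neg, Finset.sum_neg_distrib, neg_div, neg_mul, neg_neg,
    Finset.union_comm vR vL] at h
  exact h

/-- If, apart from one index `b`, every value of `v` is among the values of `c` at indices other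
than `e`, then sums over `v` and `c` differ only in the terms at `b` and `e`. -/
theorem sum_sub_eq_of_erase_matching {ι α : Type*} [DecidableEq ι] (A : Finset ι) (v c : ι → α)
    (hv : Function.Injective v) {b e : ι} (hb : b ∈ A) (he : e ∈ A)
    (h : ∀ j ∈ A.erase b, ∃ k ∈ A.erase e, c k = v j) (F : α → ℝ) :
    ∑ j ∈ A, (F (c j) - F (v j)) = F (c e) - F (v b) := by
  choose! p hp hcp using h
  have hinj : Set.InjOn p (A.erase b) := by
    intro j hj k hk hjk
    apply hv
    rw [← hcp j hj, ← hcp k hk, hjk]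
  have himage : (A.erase b).image p = A.erase e := by
    apply Finset.eq_of_subset_of_card_le (Finset.image_subset_iff.mpr hp)
    rw [Finset.card_image_of_injOn hinj, Finset.card_erase_of_mem hb, Finset.card_erase_of_mem he]
  have hsum : ∑ k ∈ A.erase e, F (c k) = ∑ j ∈ A.erase b, F (v j) := by
    rw [← himage, Finset.sum_image hinj]
    exact Finset.sum_congr rfl fun j hj => by rw [hcp j hj]
  rw [Finset.sum_sub_distrib, ← Finset.add_sum_erase A _ he,
    ← Finset.add_sum_erase A (fun j => F (v j)) hb, hsum]
  ring

theorem ols_fit_reproduces_leaf_means {m : ℕ} (y : Fin n → ℝ)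
    (vL vR : Fin m → Finset (Fin n))
    (hL : ∀ j, (vL j).Nonempty) (hR : ∀ j, (vR j).Nonempty)
    (hd : ∀ j, Disjoint (vL j) (vR j))
    (hroot : ∃! j, vL j ∪ vR j = Finset.univ)
    (hparent : ∀ j, vL j ∪ vR j ≠ Finset.univ →
      ∃! j', vL j ∪ vR j = vL j' ∨ vL j ∪ vR j = vR j')
    (hinj : ∀ j j', vL j ∪ vR j = vL j' ∪ vR j' → j = j') :
    ∀ ℓ : Finset (Fin n),
      ((∃ j, ℓ = vL j ∨ ℓ = vR j) ∧ ∀ j, vL j ∪ vR j ≠ ℓ) →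
      ∀ i ∈ ℓ,
        (n : ℝ)⁻¹ * (∑ i', y i')
          + ∑ j, ((∑ i', y i' * stump (vL j) (vR j) i') / (((vL j ∪ vR j).card : ℝ)))
              * stump (vL j) (vR j) i
          = (ℓ.card : ℝ)⁻¹ * ∑ i' ∈ ℓ, y i' := by
  rintro ℓ ⟨⟨e, he⟩, hleaf⟩ i hi
  obtain ⟨b, hb, -⟩ := hroot
  let c : Fin m → Finset (Fin n) := fun j => if i ∈ vL j then vL j else vR j
  have hc : ∀ j s, i ∈ s → (s = vL j ∨ s = vR j) → c j = s := by
    rintro j s his (rfl | rfl)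
    · exact if_pos his
    · exact if_neg (Finset.disjoint_right.mp (hd j) his)
  have hmem : ∀ j s, i ∈ s → (s = vL j ∨ s = vR j) → i ∈ vL j ∪ vR j := by
    rintro j s his (rfl | rfl)
    · exact Finset.mem_union_left _ his
    · exact Finset.mem_union_right _ his
  let A : Finset (Fin m) := Finset.univ.filter fun j => i ∈ vL j ∪ vR j
  have hA : ∀ j, j ∈ A ↔ i ∈ vL j ∪ vR j := fun j => by simp [A]
  have hterm : ∀ j ∈ A,
      (∑ i', y i' * stump (vL j) (vR j) i') / ((vL j ∪ vR j).card : ℝ) * stump (vL j) (vR j) i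
        = nodeMean y (c j) - nodeMean y (vL j ∪ vR j) := by
    intro j hj
    rcases Finset.mem_union.mp ((hA j).mp hj) with h | h
    · rw [hc j _ h (Or.inl rfl), stump_term_of_mem_left y (hR j) (hd j) h]
    · rw [hc j _ h (Or.inr rfl), stump_term_of_mem_right y (hL j) (hd j) h]
  have hmatch : ∀ j ∈ A.erase b, ∃ k ∈ A.erase e, c k = vL j ∪ vR j := by
    intro j hj
    obtain ⟨hjb, hjA⟩ := Finset.mem_erase.mp hj
    have hij := (hA j).mp hjA
    obtain ⟨k, hk, -⟩ := hparent j fun h => hjb (hinj j b (h.trans hb.symm))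
    have hck := hc k _ hij hk
    refine ⟨k, Finset.mem_erase.mpr ⟨?_, (hA k).mpr (hmem k _ hij hk)⟩, hck⟩
    rintro rfl
    exact hleaf j (hck.symm.trans (hc k ℓ hi he))
  have hsum := sum_sub_eq_of_erase_matching A (fun j => vL j ∪ vR j) c (fun j k h => hinj j k h)
    ((hA b).mpr (hb ▸ Finset.mem_univ i)) ((hA e).mpr (hmem e ℓ hi he)) hmatch (nodeMean y)
  rw [← Finset.sum_subset (Finset.subset_univ A) fun j _ hj => by
      rw [stump_of_notMem fun h => hj ((hA j).mpr h), mul_zero],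
    Finset.sum_congr rfl hterm, hsum, hc e ℓ hi he, hb]
  simp [nodeMean]
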